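/- arXiv:1807.11181 — 3 statements merged into one kernel-verified Lean document; each statement's English description precedes it below -/
import Mathlib

section
/- Let p be a prime, n, m positive integers, F : 𝔽_{p^n} → 𝔽_{p^m} a function, and θ a positive real number. Then the graph G_F is a partial geometric difference set in the additive group 𝔽_{p^n} × 𝔽_{p^m} with parameters (p^{n+m}, p^n; α, β) satisfying β − α = θ if and only if |F̂_b(a)| ∈ {0, √θ} for every nonzero b ∈ 𝔽_{p^m} and every a ∈ 𝔽_{p^n}, where F̂_b(a) = ∑_{x ∈ 𝔽_{p^n}} ζ_p^{F_b(x) − Tr_n(a x)}. In this case θ = p^{n+s} for some integer 0 ≤ s ≤ n, and α = p^{2n−m} − p^{n+s−m}, β = p^{n+s} + p^{2n−m} − p^{n+s−m}. -/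
open scoped BigOperators Classical

noncomputable instance galFintype (p n : ℕ) [Fact p.Prime] : Fintype (GaloisField p n) :=
  Fintype.ofFinite _

/-- `eChar p k = ζ_p ^ k` where `ζ_p = exp(2πi/p)` and `k : ZMod p`. -/
noncomputable def eChar (p : ℕ) (k : ZMod p) : ℂ :=
  Complex.exp (2 * Real.pi * Complex.I / p) ^ k.val

/-- Absolute trace `Tr_n : 𝔽_{p^n} → 𝔽_p`. -/
noncomputable def trGF (p n : ℕ) [Fact p.Prime] (x : GaloisField p n) : ZMod p :=
  Algebra.trace (ZMod p) (GaloisField p n) x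

/-- Walsh transform `f̂(μ) = ∑_x ζ_p^{f(x) - Tr_n(μ x)}`. -/
noncomputable def walsh (p n : ℕ) [Fact p.Prime] (f : GaloisField p n → ZMod p)
    (μ : GaloisField p n) : ℂ :=
  ∑ x : GaloisField p n, eChar p (f x - trGF p n (μ * x))

/-- `f` is `s`-plateaued: `|f̂(μ)| ∈ {0, p^{(n+s)/2}}` for all `μ`. -/
def IsPlateaued (p n : ℕ) [Fact p.Prime] (f : GaloisField p n → ZMod p) (s : ℕ) : Prop :=
  ∀ μ : GaloisField p n, ‖walsh p n f μ‖ = 0 ∨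
    ‖walsh p n f μ‖ = (p : ℝ) ^ (((n : ℝ) + (s : ℝ)) / 2)

/-- `δ_S(g) = #{(s,t) ∈ S × S : g = s - t}`. -/
def pgdsDelta {G : Type*} [AddCommGroup G] [DecidableEq G] (S : Finset G) (g : G) : ℕ :=
  ((S ×ˢ S).filter fun st => g = st.1 - st.2).card

/-- `S` is a partial geometric difference set with parameters `(v, k; α, β)`. -/
def IsPGDS {G : Type*} [AddCommGroup G] [Fintype G] [DecidableEq G]
    (S : Finset G) (v k α β : ℕ) : Prop :=
  Fintype.card G = v ∧ S.card = k ∧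
    ∀ x : G, (∑ y ∈ S, pgdsDelta S (x - y)) = if x ∈ S then β else α

/-- The canonical additive character `x ↦ ζ_p ^ Tr_n(x)` of `𝔽_{p^n}`. -/
noncomputable def traceChar (p n : ℕ) [Fact p.Prime] : AddChar (GaloisField p n) ℂ :=
  (ZMod.stdAddChar (N := p)).compAddMonoidHom
    (Algebra.trace (ZMod p) (GaloisField p n)).toAddMonoidHom

theorem eChar_eq_stdAddChar (p : ℕ) [Fact p.Prime] (k : ZMod p) :
    eChar p k = ZMod.stdAddChar k := by
  rw [ZMod.stdAddChar_apply, ZMod.toCircle_apply, eChar, ← Complex.exp_nat_mul]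
  congr 1
  ring

theorem eChar_trGF (p n : ℕ) [Fact p.Prime] (x : GaloisField p n) :
    eChar p (trGF p n x) = traceChar p n x :=
  eChar_eq_stdAddChar p _

theorem traceChar_isPrimitive (p n : ℕ) [Fact p.Prime] : (traceChar p n).IsPrimitive := by
  apply AddChar.IsPrimitive.of_ne_one
  intro h
  obtain ⟨x, hx⟩ := Algebra.trace_surjective (ZMod p) (GaloisField p n) 1
  have h1 : (ZMod.stdAddChar (N := p)) (Algebra.trace (ZMod p) (GaloisField p n) x) = 1 :=
    DFunLike.congr_fun h x
  rw [hx, ← (ZMod.stdAddChar (N := p)).map_zero_eq_one,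
    ZMod.injective_stdAddChar.eq_iff] at h1
  exact one_ne_zero h1

theorem sum_traceChar_mul (p n : ℕ) [Fact p.Prime] (b : GaloisField p n) :
    ∑ x, traceChar p n (b * x) = if b = 0 then (Fintype.card (GaloisField p n) : ℂ) else 0 := by
  simpa only [mul_comm b, Nat.cast_ite, Nat.cast_zero] using
    AddChar.sum_mulShift b (traceChar_isPrimitive p n)

theorem card_galoisField (p n : ℕ) [Fact p.Prime] (hn : 0 < n) :
    Fintype.card (GaloisField p n) = p ^ n := by
  rw [← Nat.card_eq_fintype_card, GaloisField.card p n hn.ne']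

/-- The additive character `(x, y) ↦ ζ_p ^ (Tr_m(b y) - Tr_n(a x))` of `𝔽_{p^n} × 𝔽_{p^m}`. -/
noncomputable def prodChar (p n m : ℕ) [Fact p.Prime] (a : GaloisField p n)
    (b : GaloisField p m) : AddChar (GaloisField p n × GaloisField p m) ℂ :=
  ((traceChar p m).mulShift b).compAddMonoidHom (AddMonoidHom.snd _ _) *
    ((traceChar p n).mulShift (-a)).compAddMonoidHom (AddMonoidHom.fst _ _)

theorem prodChar_apply (p n m : ℕ) [Fact p.Prime] (a : GaloisField p n) (b : GaloisField p m)
    (g : GaloisField p n × GaloisField p m) :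
    prodChar p n m a b g = traceChar p m (b * g.2) * traceChar p n (-a * g.1) := rfl

theorem walsh_eq_sum_prodChar (p n m : ℕ) [Fact p.Prime] (F : GaloisField p n → GaloisField p m)
    (a : GaloisField p n) (b : GaloisField p m) :
    walsh p n (fun x => trGF p m (b * F x)) a = ∑ x, prodChar p n m a b (x, F x) := by
  refine Finset.sum_congr rfl fun x _ => ?_
  rw [prodChar_apply, eChar_eq_stdAddChar, sub_eq_add_neg, AddChar.map_add_eq_mul,
    ← eChar_trGF, ← eChar_trGF, eChar_eq_stdAddChar, eChar_eq_stdAddChar, neg_mul]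
  simp [trGF]

theorem sum_prodChar (p n m : ℕ) [Fact p.Prime] (a : GaloisField p n) (b : GaloisField p m) :
    ∑ g, prodChar p n m a b g = if a = 0 ∧ b = 0 then
      (Fintype.card (GaloisField p n × GaloisField p m) : ℂ) else 0 := by
  simp only [prodChar_apply]
  rw [Fintype.sum_prod_type_right]
  simp only [← Finset.mul_sum]
  rw [← Finset.sum_mul, sum_traceChar_mul, sum_traceChar_mul]
  by_cases ha : a = 0 <;> by_cases hb : b = 0 <;> simp [ha, hb, mul_comm]

theorem sum_prodChar_dual (p n m : ℕ) [Fact p.Prime] (g : GaloisField p n × GaloisField p m) :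
    ∑ i : GaloisField p n × GaloisField p m, prodChar p n m i.1 i.2 g =
      if g = 0 then (Fintype.card (GaloisField p n × GaloisField p m) : ℂ) else 0 := by
  have symm : ∀ i : GaloisField p n × GaloisField p m,
      prodChar p n m i.1 i.2 g = prodChar p n m g.1 g.2 i := fun i => by
    simp only [prodChar_apply, neg_mul, mul_comm i.1, mul_comm i.2]
  simp only [symm, sum_prodChar, Prod.ext_iff, Prod.fst_zero, Prod.snd_zero]

/-- Injectivity of the Fourier transform on `𝔽_{p^n} × 𝔽_{p^m}`. -/
theorem eq_zero_of_sum_mul_prodChar_eq_zero (p n m : ℕ) [Fact p.Prime]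
    (f : GaloisField p n × GaloisField p m → ℂ)
    (hf : ∀ a b, ∑ g, f g * prodChar p n m a b g = 0) (h : GaloisField p n × GaloisField p m) :
    f h = 0 := by
  have hsum : ∑ i : GaloisField p n × GaloisField p m,
      prodChar p n m i.1 i.2 (-h) * ∑ g, f g * prodChar p n m i.1 i.2 g = 0 := by
    simp [hf]
  simp only [Finset.mul_sum] at hsum
  rw [Finset.sum_comm] at hsum
  have inner : ∀ g, ∑ i : GaloisField p n × GaloisField p m,
      prodChar p n m i.1 i.2 (-h) * (f g * prodChar p n m i.1 i.2 g) =
        if g = h then f g * Fintype.card (GaloisField p n × GaloisField p m) else 0 := fun g => by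
    have e : ∀ i : GaloisField p n × GaloisField p m,
        prodChar p n m i.1 i.2 (-h) * (f g * prodChar p n m i.1 i.2 g) =
          f g * prodChar p n m i.1 i.2 (g - h) := fun i => by
      rw [sub_eq_add_neg, AddChar.map_add_eq_mul]
      ring
    simp only [e, ← Finset.mul_sum, sum_prodChar_dual, sub_eq_zero, mul_ite, mul_zero]
  simp only [inner, Finset.sum_ite_eq', Finset.mem_univ, if_true] at hsum
  exact (mul_eq_zero.mp hsum).resolve_right (Nat.cast_ne_zero.mpr Fintype.card_ne_zero)

theorem sum_pgdsDelta_mul {G : Type*} [AddCommGroup G] [Fintype G] [DecidableEq G]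
    (S : Finset G) (χ : AddChar G ℂ) :
    ∑ g, (pgdsDelta S g : ℂ) * χ g = (‖∑ s ∈ S, χ s‖ ^ 2 : ℝ) := by
  have hδ : ∀ g, (pgdsDelta S g : ℂ) * χ g =
      ∑ st ∈ S ×ˢ S, if g = st.1 - st.2 then χ g else 0 := fun g => by
    rw [pgdsDelta, Finset.card_filter, Nat.cast_sum, Finset.sum_mul]
    exact Finset.sum_congr rfl fun st _ => by split_ifs <;> simp
  simp only [hδ]
  rw [Finset.sum_comm]
  simp only [Finset.sum_ite_eq', Finset.mem_univ, if_true]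
  rw [Complex.ofReal_pow, ← Complex.mul_conj', map_sum, Finset.sum_mul_sum, Finset.sum_product]
  refine Finset.sum_congr rfl fun s _ => Finset.sum_congr rfl fun t _ => ?_
  rw [sub_eq_add_neg, AddChar.map_add_eq_mul, AddChar.map_neg_eq_conj]

theorem sum_sum_pgdsDelta_mul {G : Type*} [AddCommGroup G] [Fintype G] [DecidableEq G]
    (S : Finset G) (χ : AddChar G ℂ) :
    ∑ x, ((∑ y ∈ S, pgdsDelta S (x - y) : ℕ) : ℂ) * χ x =
      (‖∑ s ∈ S, χ s‖ ^ 2 : ℝ) * ∑ s ∈ S, χ s := by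
  rw [← sum_pgdsDelta_mul, Finset.mul_sum]
  simp only [Nat.cast_sum, Finset.sum_mul]
  rw [Finset.sum_comm]
  refine Finset.sum_congr rfl fun y _ => ?_
  rw [← Equiv.sum_comp (Equiv.addRight y)]
  refine Finset.sum_congr rfl fun x _ => ?_
  rw [Equiv.coe_addRight, add_sub_cancel_right, AddChar.map_add_eq_mul, mul_assoc]

/-- The graph of `F : 𝔽_{p^n} → 𝔽_{p^m}`. -/
noncomputable def graphFinset (p n m : ℕ) [Fact p.Prime] (F : GaloisField p n → GaloisField p m) :
    Finset (GaloisField p n × GaloisField p m) :=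
  Finset.univ.image fun x => (x, F x)

section Graph

variable (p n m : ℕ) [Fact p.Prime] (F : GaloisField p n → GaloisField p m)

theorem sum_graphFinset (f : GaloisField p n × GaloisField p m → ℂ) :
    ∑ s ∈ graphFinset p n m F, f s = ∑ x, f (x, F x) :=
  Finset.sum_image fun _ _ _ _ h => congrArg Prod.fst h

theorem card_graphFinset : (graphFinset p n m F).card = Fintype.card (GaloisField p n) :=
  Finset.card_image_of_injective _ fun _ _ h => congrArg Prod.fst h

theorem mem_graphFinset (g : GaloisField p n × GaloisField p m) :
    g ∈ graphFinset p n m F ↔ F g.1 = g.2 := by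
  simp only [graphFinset, Finset.mem_image, Finset.mem_univ, true_and]
  exact ⟨by rintro ⟨x, rfl⟩; rfl, fun h => ⟨g.1, by rw [h]⟩⟩

theorem sum_graphFinset_prodChar_zero (a : GaloisField p n) :
    ∑ s ∈ graphFinset p n m F, prodChar p n m a 0 s =
      if a = 0 then (Fintype.card (GaloisField p n) : ℂ) else 0 := by
  rw [sum_graphFinset]
  simp only [prodChar_apply, zero_mul, AddChar.map_zero_eq_one, one_mul, sum_traceChar_mul,
    neg_eq_zero]

/-- Parseval's identity for the Walsh transform of a component function. -/
theorem sum_norm_sq_walsh (b : GaloisField p m) :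
    ∑ a, ‖walsh p n (fun x => trGF p m (b * F x)) a‖ ^ 2 =
      (Fintype.card (GaloisField p n) : ℝ) ^ 2 := by
  have expand : ∀ a, ((‖walsh p n (fun x => trGF p m (b * F x)) a‖ ^ 2 : ℝ) : ℂ) =
      ∑ x, ∑ y, traceChar p m (b * (F x - F y)) * traceChar p n ((y - x) * a) := fun a => by
    rw [Complex.ofReal_pow, ← Complex.mul_conj', walsh_eq_sum_prodChar, map_sum,
      Finset.sum_mul_sum]
    refine Finset.sum_congr rfl fun x _ => Finset.sum_congr rfl fun y _ => ?_
    rw [← AddChar.map_neg_eq_conj, ← AddChar.map_add_eq_mul, prodChar_apply]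
    congr 2 <;> simp only [Prod.fst_add, Prod.snd_add, Prod.fst_neg, Prod.snd_neg] <;> ring
  rw [← Complex.ofReal_inj, Complex.ofReal_sum]
  simp only [expand]
  rw [Finset.sum_comm]
  have inner : ∀ x, ∑ a, ∑ y, traceChar p m (b * (F x - F y)) * traceChar p n ((y - x) * a) =
      Fintype.card (GaloisField p n) := fun x => by
    rw [Finset.sum_comm]
    simp only [← Finset.mul_sum, sum_traceChar_mul, sub_eq_zero, mul_ite, mul_zero,
      Finset.sum_ite_eq', Finset.mem_univ, if_true, sub_self, AddChar.map_zero_eq_one, one_mul]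
  simp [inner, sq]

theorem isPGDS_graphFinset_iff (hn : 0 < n) (hm : 0 < m) (α β : ℕ) :
    IsPGDS (graphFinset p n m F) (p ^ (n + m)) (p ^ n) α β ↔
      ∀ x, (((∑ y ∈ graphFinset p n m F, pgdsDelta (graphFinset p n m F) (x - y) : ℕ)) : ℂ) =
        α + ((β : ℂ) - α) * if x ∈ graphFinset p n m F then 1 else 0 := by
  have hcard : Fintype.card (GaloisField p n × GaloisField p m) = p ^ (n + m) := by
    rw [Fintype.card_prod, card_galoisField p n hn, card_galoisField p m hm, pow_add]
  have hS : (graphFinset p n m F).card = p ^ n := by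
    rw [card_graphFinset, card_galoisField p n hn]
  simp only [IsPGDS, hcard, hS, true_and]
  refine forall_congr' fun x => ?_
  rw [← Nat.cast_inj (R := ℂ)]
  split_ifs <;> simp

/-- Fourier transform of the defining identity of a partial geometric difference set. -/
theorem norm_sq_mul_of_isPGDS (hn : 0 < n) (hm : 0 < m) {α β : ℕ}
    (h : IsPGDS (graphFinset p n m F) (p ^ (n + m)) (p ^ n) α β)
    (a : GaloisField p n) (b : GaloisField p m) :
    ((‖∑ s ∈ graphFinset p n m F, prodChar p n m a b s‖ ^ 2 : ℝ) : ℂ) *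
        ∑ s ∈ graphFinset p n m F, prodChar p n m a b s =
      α * ∑ g, prodChar p n m a b g +
        ((β : ℂ) - α) * ∑ s ∈ graphFinset p n m F, prodChar p n m a b s := by
  rw [← sum_sum_pgdsDelta_mul]
  simp only [(isPGDS_graphFinset_iff p n m F hn hm α β).mp h, add_mul, Finset.sum_add_distrib,
    mul_assoc, ite_mul, one_mul, zero_mul, ← Finset.mul_sum, Finset.sum_ite_mem,
    Finset.univ_inter]

theorem norm_walsh_of_isPGDS (hn : 0 < n) (hm : 0 < m) {α β : ℕ} {θ : ℝ}
    (h : IsPGDS (graphFinset p n m F) (p ^ (n + m)) (p ^ n) α β) (hαβ : (β : ℝ) - α = θ)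
    (b : GaloisField p m) (hb : b ≠ 0) (a : GaloisField p n) :
    ‖walsh p n (fun x => trGF p m (b * F x)) a‖ = 0 ∨
      ‖walsh p n (fun x => trGF p m (b * F x)) a‖ = √θ := by
  have key := norm_sq_mul_of_isPGDS p n m F hn hm h a b
  rw [sum_prodChar, if_neg (fun h => hb h.2), mul_zero, zero_add, sum_graphFinset,
    ← walsh_eq_sum_prodChar] at key
  by_cases hw : walsh p n (fun x => trGF p m (b * F x)) a = 0
  · exact Or.inl (by rw [hw, norm_zero])
  · right
    have hsq := mul_right_cancel₀ hw key
    have hsq' : ‖walsh p n (fun x => trGF p m (b * F x)) a‖ ^ 2 = θ := by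
      rw [← hαβ]
      exact_mod_cast hsq
    rw [← hsq', Real.sqrt_sq (norm_nonneg _)]

theorem pow_two_mul_eq_of_isPGDS (hn : 0 < n) (hm : 0 < m) {α β : ℕ} {θ : ℝ}
    (h : IsPGDS (graphFinset p n m F) (p ^ (n + m)) (p ^ n) α β) (hαβ : (β : ℝ) - α = θ) :
    (p : ℝ) ^ (2 * n) = α * (p : ℝ) ^ m + θ := by
  have key := norm_sq_mul_of_isPGDS p n m F hn hm h 0 0
  rw [sum_prodChar, sum_graphFinset_prodChar_zero] at key
  simp only [and_self, if_true, Fintype.card_prod, card_galoisField p n hn,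
    card_galoisField p m hm, Complex.norm_natCast] at key
  have key' : ((p : ℝ) ^ n) ^ 2 * (p : ℝ) ^ n =
      α * ((p : ℝ) ^ n * (p : ℝ) ^ m) + (β - α) * (p : ℝ) ^ n := by
    exact_mod_cast key
  rw [hαβ] at key'
  have hp : (p : ℝ) ^ n ≠ 0 :=
    pow_ne_zero _ (Nat.cast_ne_zero.mpr (Fact.out : p.Prime).ne_zero)
  apply mul_right_cancel₀ hp
  rw [mul_comm 2 n, pow_mul, key']
  ring

theorem exists_isPGDS_of_norm_walsh (hn : 0 < n) (hm : 0 < m) {θ : ℝ} (hθ : 0 < θ)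
    (h : ∀ b : GaloisField p m, b ≠ 0 → ∀ a : GaloisField p n,
      ‖walsh p n (fun x => trGF p m (b * F x)) a‖ = 0 ∨
        ‖walsh p n (fun x => trGF p m (b * F x)) a‖ = √θ) :
    ∃ α β : ℕ, IsPGDS (graphFinset p n m F) (p ^ (n + m)) (p ^ n) α β ∧ (β : ℝ) - α = θ := by
  set S := graphFinset p n m F with hS
  set q : ℂ := (Fintype.card (GaloisField p n) : ℂ) with hq
  set v : ℂ := (Fintype.card (GaloisField p n × GaloisField p m) : ℂ) with hv
  have hv0 : v ≠ 0 := Nat.cast_ne_zero.mpr Fintype.card_ne_zero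
  set c : ℂ := (q ^ 2 * q - θ * q) / v with hc
  have formula : ∀ x, ((∑ y ∈ S, pgdsDelta S (x - y) : ℕ) : ℂ) =
      c + θ * if x ∈ S then 1 else 0 := by
    intro x
    rw [← sub_eq_zero]
    refine eq_zero_of_sum_mul_prodChar_eq_zero p n m (fun x =>
      ((∑ y ∈ S, pgdsDelta S (x - y) : ℕ) : ℂ) - (c + θ * if x ∈ S then 1 else 0))
      (fun a b => ?_) x
    simp only [sub_mul, add_mul, Finset.sum_sub_distrib, Finset.sum_add_distrib,
      sum_sum_pgdsDelta_mul, mul_assoc, ite_mul, one_mul, zero_mul, ← Finset.mul_sum,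
      Finset.sum_ite_mem, Finset.univ_inter]
    by_cases hb : b = 0
    · subst hb
      rw [sum_prodChar, hS, sum_graphFinset_prodChar_zero]
      by_cases ha : a = 0
      · simp only [ha, and_self, if_true, ← hq, ← hv, hc]
        rw [div_mul_cancel₀ _ hv0, hq, Complex.norm_natCast]
        push_cast
        ring
      · simp [ha]
    · rw [sum_prodChar, if_neg (fun h => hb h.2), hS, sum_graphFinset, ← walsh_eq_sum_prodChar]
      rcases h b hb a with h0 | h1
      · rw [norm_eq_zero.mp h0]
        simp
      · rw [h1, Real.sq_sqrt hθ.le]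
        ring
  have hx : ((0, F 0) : GaloisField p n × GaloisField p m) ∈ S :=
    (mem_graphFinset p n m F _).mpr rfl
  have hy : ((0, F 0 + 1) : GaloisField p n × GaloisField p m) ∉ S := fun h => by
    simpa using (mem_graphFinset p n m F _).mp h
  have hβ := formula (0, F 0)
  have hα := formula (0, F 0 + 1)
  rw [if_pos hx, mul_one] at hβ
  rw [if_neg hy, mul_zero, add_zero] at hα
  refine ⟨_, _, (isPGDS_graphFinset_iff p n m F hn hm
    (∑ y ∈ S, pgdsDelta S ((0, F 0 + 1) - y)) (∑ y ∈ S, pgdsDelta S ((0, F 0) - y))).mpr ?_, ?_⟩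
  · intro x
    rw [hα, hβ, add_sub_cancel_left]
    exact formula x
  · rw [← Complex.ofReal_inj, Complex.ofReal_sub, Complex.ofReal_natCast, Complex.ofReal_natCast,
      hα, hβ, add_sub_cancel_left]

theorem exists_eq_pow_of_isPGDS (hn : 0 < n) (hm : 0 < m) {α β : ℕ} {θ : ℝ} (hθ : 0 < θ)
    (h : IsPGDS (graphFinset p n m F) (p ^ (n + m)) (p ^ n) α β) (hαβ : (β : ℝ) - α = θ) :
    ∃ s ≤ n, θ = (p : ℝ) ^ (n + s) := by
  have hp : p.Prime := Fact.out
  have hle : α ≤ β := by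
    have : (α : ℝ) ≤ β := by linarith
    exact_mod_cast this
  have hd : ((β - α : ℕ) : ℝ) = θ := by rw [Nat.cast_sub hle, hαβ]
  set N := (Finset.univ.filter fun a =>
    ‖walsh p n (fun x => trGF p m ((1 : GaloisField p m) * F x)) a‖ ≠ 0).card with hN
  have hNle : N ≤ p ^ n := by
    rw [← card_galoisField p n hn]
    exact Finset.card_le_univ _
  have parseval := sum_norm_sq_walsh p n m F 1
  have term : ∀ a, ‖walsh p n (fun x => trGF p m ((1 : GaloisField p m) * F x)) a‖ ^ 2 =
      if ‖walsh p n (fun x => trGF p m ((1 : GaloisField p m) * F x)) a‖ ≠ 0 then θ else 0 :=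
    fun a => by
      split_ifs with h0
      · rw [(norm_walsh_of_isPGDS p n m F hn hm h hαβ 1 one_ne_zero a).resolve_left h0,
          Real.sq_sqrt hθ.le]
      · rw [not_not.mp h0]
        norm_num
  rw [Finset.sum_congr rfl fun a _ => term a, ← Finset.sum_filter, Finset.sum_const, nsmul_eq_mul,
    ← hN, ← hd, card_galoisField p n hn] at parseval
  have hmul : N * (β - α) = p ^ (2 * n) := by
    rw [mul_comm 2 n, pow_mul]
    exact_mod_cast parseval
  obtain ⟨j, hj, hjeq⟩ := (Nat.dvd_prime_pow hp).mp (Dvd.intro_left N hmul)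
  have hnj : n ≤ j := by
    have : p ^ (2 * n) ≤ p ^ (n + j) := by
      rw [← hmul, hjeq, pow_add]
      exact Nat.mul_le_mul_right _ hNle
    have := (Nat.pow_le_pow_iff_right hp.one_lt).mp this
    omega
  refine ⟨j - n, by omega, ?_⟩
  rw [← hd, hjeq, Nat.add_sub_cancel' hnj, Nat.cast_pow]

end Graph

/-- the graph of `F : 𝔽_{p^n} → 𝔽_{p^m}` is a PGDS with parameters
`(p^{n+m}, p^n; α, β)`, `β - α = θ`, iff all nonzero component Walsh transforms have
absolute value in `{0, √θ}`; in this case `θ = p^{n+s}` with `0 ≤ s ≤ n`,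
`α = p^{2n-m} - p^{n+s-m}` and `β = p^{n+s} + p^{2n-m} - p^{n+s-m}`. -/
theorem stmt0 (p n m : ℕ) [Fact p.Prime] (hn : 0 < n) (hm : 0 < m)
    (F : GaloisField p n → GaloisField p m) (θ : ℝ) (hθ : 0 < θ) :
    ((∃ α β : ℕ,
        IsPGDS ((Finset.univ : Finset (GaloisField p n)).image fun x => (x, F x))
          (p ^ (n + m)) (p ^ n) α β ∧ (β : ℝ) - (α : ℝ) = θ) ↔
      ∀ b : GaloisField p m, b ≠ 0 → ∀ a : GaloisField p n,
        ‖walsh p n (fun x => trGF p m (b * F x)) a‖ = 0 ∨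
        ‖walsh p n (fun x => trGF p m (b * F x)) a‖ = Real.sqrt θ) ∧
    (∀ α β : ℕ,
        IsPGDS ((Finset.univ : Finset (GaloisField p n)).image fun x => (x, F x))
          (p ^ (n + m)) (p ^ n) α β ∧ (β : ℝ) - (α : ℝ) = θ →
      ∃ s : ℕ, s ≤ n ∧ θ = (p : ℝ) ^ (n + s) ∧
        (α : ℝ) = (p : ℝ) ^ (2 * (n : ℤ) - (m : ℤ)) - (p : ℝ) ^ ((n : ℤ) + (s : ℤ) - (m : ℤ)) ∧
        (β : ℝ) = (p : ℝ) ^ (n + s) +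
          (p : ℝ) ^ (2 * (n : ℤ) - (m : ℤ)) - (p : ℝ) ^ ((n : ℤ) + (s : ℤ) - (m : ℤ))) := by
  refine ⟨⟨?_, exists_isPGDS_of_norm_walsh p n m F hn hm hθ⟩, ?_⟩
  · rintro ⟨α, β, h, hαβ⟩
    exact norm_walsh_of_isPGDS p n m F hn hm h hαβ
  · rintro α β ⟨h, hαβ⟩
    obtain ⟨s, hs, rfl⟩ := exists_eq_pow_of_isPGDS p n m F hn hm hθ h hαβ
    have hp : (p : ℝ) ≠ 0 := Nat.cast_ne_zero.mpr (Fact.out : p.Prime).ne_zero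
    have hα : (α : ℝ) =
        (p : ℝ) ^ (2 * (n : ℤ) - (m : ℤ)) - (p : ℝ) ^ ((n : ℤ) + (s : ℤ) - (m : ℤ)) := by
      rw [zpow_sub₀ hp, zpow_sub₀ hp, ← sub_div, zpow_natCast, eq_div_iff (pow_ne_zero _ hp)]
      have key := pow_two_mul_eq_of_isPGDS p n m F hn hm h hαβ
      exact_mod_cast (eq_sub_of_add_eq key.symm)
    refine ⟨s, hs, rfl, hα, ?_⟩
    rw [add_sub_assoc, ← hα, ← hαβ, sub_add_cancel]
end

section
/- Let p be a prime, F : 𝔽_{p^n} → 𝔽_{p^m} a function, and α, β constants. The graph G_F is a partial geometric difference set in 𝔽_{p^n} × 𝔽_{p^m} with parameters (p^{n+m}, p^n; α, β) if and only if for every x ∈ 𝔽_{p^n} and every c ∈ 𝔽_{p^m}, the number N_F(c, x) of pairs (t, a) ∈ 𝔽_{p^n} × 𝔽_{p^n} with D_t F(a) − D_t F(x) = c equals α when c ≠ 0 and equals β when c = 0. -/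
open scoped BigOperators Classical

section GraphCount

variable {A B : Type*} [AddCommGroup B] [Fintype A]

theorem pgdsDelta_graph [AddCommGroup A] (F : A → B) (x a : A) (c : B) :
    pgdsDelta ((Finset.univ : Finset A).image fun x => (x, F x)) ((x, F x - c) - (a, F a)) =
      (Finset.univ.filter fun t => (F (a + t) - F a) - (F (x + t) - F x) = c).card := by
  unfold pgdsDelta
  symm
  refine Finset.card_bij (fun t _ => ((x + t, F (x + t)), (a + t, F (a + t)))) ?_ ?_ ?_
  · intro t ht
    simp only [Finset.mem_filter, Finset.mem_univ, true_and] at ht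
    simp only [Finset.mem_filter, Finset.mem_product, Finset.mem_image, Finset.mem_univ,
      true_and, Prod.mk_sub_mk, Prod.mk.injEq]
    refine ⟨⟨⟨_, rfl, rfl⟩, ⟨_, rfl, rfl⟩⟩, by abel, ?_⟩
    rw [← ht]
    abel
  · intro t _ t' _ h
    simpa using congrArg (fun q => q.1.1) h
  · rintro ⟨q, r⟩ h
    simp only [Finset.mem_filter, Finset.mem_product, Finset.mem_image, Finset.mem_univ,
      true_and] at h
    obtain ⟨⟨⟨s, rfl⟩, ⟨u, rfl⟩⟩, h⟩ := h
    simp only [Prod.mk_sub_mk, Prod.mk.injEq] at h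
    obtain ⟨h₁, h₂⟩ := h
    have hs : x + (u - a) = s := by
      rw [← sub_add_cancel s u, ← h₁]
      abel
    have hu : a + (u - a) = u := by abel
    refine ⟨u - a, ?_, by rw [hs, hu]⟩
    simp only [Finset.mem_filter, Finset.mem_univ, true_and, hs, hu]
    have hc : c = F x - F a - (F s - F u) := by
      rw [← h₂]
      abel
    rw [hc]
    abel

theorem sum_pgdsDelta_graph [AddCommGroup A] (F : A → B) (x : A) (c : B) :
    ∑ y ∈ (Finset.univ : Finset A).image fun x => (x, F x),
        pgdsDelta ((Finset.univ : Finset A).image fun x => (x, F x)) ((x, F x - c) - y) =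
      ((Finset.univ : Finset (A × A)).filter fun ta =>
        (F (ta.2 + ta.1) - F ta.2) - (F (x + ta.1) - F x) = c).card := by
  rw [Finset.sum_image fun _ _ _ _ h => congrArg Prod.fst h, Finset.card_filter,
    Fintype.sum_prod_type_right]
  refine Finset.sum_congr rfl fun a _ => ?_
  rw [pgdsDelta_graph, Finset.card_filter]

theorem mem_graph_sub_iff (F : A → B) (x : A) (c : B) :
    (x, F x - c) ∈ ((Finset.univ : Finset A).image fun x => (x, F x)) ↔ c = 0 := by
  simp [eq_comm (a := F x)]

end GraphCount

/-- the graph of `F` is a PGDS with parameters `(p^{n+m}, p^n; α, β)` iff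
for all `x, c`, `N_F(c,x) = #{(t,a) : D_t F(a) - D_t F(x) = c}` equals `β` when `c = 0`
and `α` when `c ≠ 0`. -/
theorem stmt1 (p n m : ℕ) [Fact p.Prime] (hn : 0 < n) (hm : 0 < m)
    (F : GaloisField p n → GaloisField p m) (α β : ℕ) :
    IsPGDS ((Finset.univ : Finset (GaloisField p n)).image fun x => (x, F x))
        (p ^ (n + m)) (p ^ n) α β ↔
      ∀ (x : GaloisField p n) (c : GaloisField p m),
        ((Finset.univ : Finset (GaloisField p n × GaloisField p n)).filter fun ta =>
            (F (ta.2 + ta.1) - F ta.2) - (F (x + ta.1) - F x) = c).card =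
          if c = 0 then β else α := by
  have hcard (k : ℕ) (hk : 0 < k) : Fintype.card (GaloisField p k) = p ^ k := by
    rw [← Nat.card_eq_fintype_card, GaloisField.card p k hk.ne']
  constructor
  · rintro ⟨-, -, h⟩ x c
    rw [← sum_pgdsDelta_graph, h]
    simp only [mem_graph_sub_iff]
  · intro h
    refine ⟨by rw [Fintype.card_prod, hcard n hn, hcard m hm, pow_add], ?_, ?_⟩
    · rw [Finset.card_image_of_injective _ fun _ _ h => congrArg Prod.fst h, Finset.card_univ,
        hcard n hn]
    · rintro ⟨x, w⟩
      obtain ⟨c, rfl⟩ : ∃ c, w = F x - c := ⟨F x - w, by abel⟩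
      rw [sum_pgdsDelta_graph, h]
      simp only [mem_graph_sub_iff]
end

section
/- Let p be a prime, f : 𝔽_{p^n} → 𝔽_p a function, and let M be the p^n × p^n complex matrix, with rows and columns indexed by 𝔽_{p^n}, whose (x,y) entry is ζ_p^{f(x+y)}. Then f is s-plateaued if and only if M M* M = p^{n+s} M, where M* denotes the conjugate transpose of M. -/
open scoped BigOperators Classical

theorem traceChar_apply (p n : ℕ) [Fact p.Prime] (x : GaloisField p n) :
    traceChar p n x = ZMod.stdAddChar (trGF p n x) := rfl

theorem conj_traceChar (p n : ℕ) [Fact p.Prime] (x : GaloisField p n) :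
    star (traceChar p n x) = traceChar p n (-x) :=
  (AddChar.map_neg_eq_conj (traceChar p n) x).symm

theorem walsh_eq_sum_traceChar (p n : ℕ) [Fact p.Prime] (f : GaloisField p n → ZMod p)
    (μ : GaloisField p n) :
    walsh p n f μ = ∑ x, eChar p (f x) * traceChar p n (-(μ * x)) := by
  refine Finset.sum_congr rfl fun x _ => ?_
  rw [eChar_eq_stdAddChar, eChar_eq_stdAddChar, traceChar_apply, ← AddChar.map_add_eq_mul]
  simp [trGF, sub_eq_add_neg]

/-- The Fourier matrix of `𝔽_{p^n}`, with entries `ζ_p ^ (-Tr_n (μ y))`. -/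
noncomputable def fourierMatrix (p n : ℕ) [Fact p.Prime] :
    Matrix (GaloisField p n) (GaloisField p n) ℂ :=
  Matrix.of fun y μ => traceChar p n (-(μ * y))

theorem fourierMatrix_mul_conjTranspose (p n : ℕ) [Fact p.Prime] :
    fourierMatrix p n * (fourierMatrix p n).conjTranspose =
      (Fintype.card (GaloisField p n) : ℂ) • 1 := by
  ext x y
  have h := AddChar.sum_mulShift (y - x) (traceChar_isPrimitive p n)
  simp only [Matrix.mul_apply, Matrix.conjTranspose_apply, fourierMatrix, Matrix.of_apply,
    conj_traceChar, Matrix.smul_apply, Matrix.one_apply, ← AddChar.map_add_eq_mul]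
  calc _ = ∑ μ, traceChar p n (μ * (y - x)) :=
        Finset.sum_congr rfl fun μ _ => by congr 1; ring
    _ = _ := by
        rw [h]
        by_cases hxy : x = y
        · simp [hxy]
        · simp [hxy, sub_eq_zero, Ne.symm hxy]

theorem mul_fourierMatrix_injective (p n : ℕ) [Fact p.Prime]
    {A B : Matrix (GaloisField p n) (GaloisField p n) ℂ}
    (h : A * fourierMatrix p n = B * fourierMatrix p n) : A = B := by
  have h' := congrArg (· * (fourierMatrix p n).conjTranspose) h
  simp only [Matrix.mul_assoc, fourierMatrix_mul_conjTranspose, Matrix.mul_smul,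
    Matrix.mul_one] at h'
  exact smul_right_injective _ (Nat.cast_ne_zero.mpr Fintype.card_ne_zero) h'

/-- `M` sends the conjugate of each character to a multiple of that character, the factor being
the Walsh coefficient. -/
theorem mul_fourierMatrix_eq (p n : ℕ) [Fact p.Prime] (f : GaloisField p n → ZMod p)
    (M : Matrix (GaloisField p n) (GaloisField p n) ℂ)
    (hM : ∀ x y : GaloisField p n, M x y = eChar p (f (x + y))) :
    M * fourierMatrix p n =
      (fourierMatrix p n).map star * Matrix.diagonal (walsh p n f) := by
  ext x μ
  rw [Matrix.mul_diagonal, Matrix.mul_apply, walsh_eq_sum_traceChar, Finset.mul_sum]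
  refine Eq.trans ?_ (Equiv.sum_comp (Equiv.addLeft x) _)
  refine Finset.sum_congr rfl fun y _ => ?_
  simp only [hM, fourierMatrix, Matrix.of_apply, Matrix.map_apply, conj_traceChar,
    Equiv.coe_addLeft]
  rw [mul_left_comm, ← AddChar.map_add_eq_mul]
  congr 2
  ring

theorem conjTranspose_mul_fourierMatrix_map_star_eq (p n : ℕ) [Fact p.Prime] (f : GaloisField p n → ZMod p)
    (M : Matrix (GaloisField p n) (GaloisField p n) ℂ)
    (hM : ∀ x y : GaloisField p n, M x y = eChar p (f (x + y))) :
    M.conjTranspose * (fourierMatrix p n).map star =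
      fourierMatrix p n * Matrix.diagonal (star (walsh p n f)) := by
  have hsymm : M.conjTranspose = M.map star := by
    ext x y
    simp [hM, add_comm]
  have h := congrArg (fun A => A.map (starRingEnd ℂ)) (mul_fourierMatrix_eq p n f M hM)
  simp only [Matrix.map_mul] at h
  rw [hsymm]
  refine h.trans ?_
  congr 1
  · ext x y
    simp
  · rw [Matrix.diagonal_map (map_zero _)]
    rfl

theorem mul_conjTranspose_mul_eq_smul_iff (p n : ℕ) [Fact p.Prime] (f : GaloisField p n → ZMod p)
    (M : Matrix (GaloisField p n) (GaloisField p n) ℂ)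
    (hM : ∀ x y : GaloisField p n, M x y = eChar p (f (x + y))) (c : ℂ) :
    M * M.conjTranspose * M = c • M ↔
      ∀ μ, walsh p n f μ * star (walsh p n f μ) * walsh p n f μ = c * walsh p n f μ := by
  have hF := mul_fourierMatrix_eq p n f M hM
  have hcube : M * M.conjTranspose * M * fourierMatrix p n =
      (fourierMatrix p n).map star * Matrix.diagonal
        (fun μ => walsh p n f μ * star (walsh p n f μ) * walsh p n f μ) := by
    rw [Matrix.mul_assoc, hF, ← Matrix.mul_assoc, Matrix.mul_assoc M,
      conjTranspose_mul_fourierMatrix_map_star_eq p n f M hM, ← Matrix.mul_assoc M, hF]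
    simp only [Matrix.mul_assoc, Matrix.diagonal_mul_diagonal, Pi.star_apply]
  have hsmul : (c • M) * fourierMatrix p n =
      (fourierMatrix p n).map star * Matrix.diagonal (fun μ => c * walsh p n f μ) := by
    rw [Matrix.smul_mul, hF, ← Matrix.mul_smul, ← Matrix.diagonal_smul]
    rfl
  constructor
  · intro h μ
    have h0 := congrFun (congrFun (hcube.symm.trans ((congrArg (· * _) h).trans hsmul)) 0) μ
    simpa [Matrix.mul_diagonal, fourierMatrix] using h0
  · intro h
    apply mul_fourierMatrix_injective p n
    rw [hcube, hsmul, funext h]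

theorem mul_star_mul_self_eq_iff (z : ℂ) {r : ℝ} (hr : 0 ≤ r) :
    z * star z * z = (r : ℂ) ^ 2 * z ↔ ‖z‖ = 0 ∨ ‖z‖ = r := by
  have hz : z * star z = (‖z‖ : ℂ) ^ 2 := Complex.mul_conj' z
  rw [hz, mul_eq_mul_right_iff, or_comm, norm_eq_zero, ← Complex.ofReal_pow,
    ← Complex.ofReal_pow, Complex.ofReal_inj, sq_eq_sq₀ (norm_nonneg z) hr]

/-- `f` is `s`-plateaued iff the matrix `M` with entries
`M_{x,y} = ζ_p^{f(x+y)}` satisfies `M M* M = p^{n+s} M`. -/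
theorem stmt9 (p n : ℕ) [Fact p.Prime] (hn : 0 < n) (s : ℕ)
    (f : GaloisField p n → ZMod p)
    (M : Matrix (GaloisField p n) (GaloisField p n) ℂ)
    (hM : ∀ x y : GaloisField p n, M x y = eChar p (f (x + y))) :
    IsPlateaued p n f s ↔
      M * M.conjTranspose * M = ((p : ℂ) ^ (n + s)) • M := by
  have hr : (0 : ℝ) ≤ (p : ℝ) ^ (((n : ℝ) + (s : ℝ)) / 2) := by positivity
  have hsq : ((p : ℝ) ^ (((n : ℝ) + (s : ℝ)) / 2)) ^ 2 = (p : ℝ) ^ (n + s) := by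
    rw [← Real.rpow_mul_natCast p.cast_nonneg, ← Real.rpow_natCast]
    congr 1
    push_cast
    ring
  have hc : (p : ℂ) ^ (n + s) = (((p : ℝ) ^ (((n : ℝ) + (s : ℝ)) / 2) : ℝ) : ℂ) ^ 2 := by
    rw [← Complex.ofReal_pow, hsq]
    push_cast
    rfl
  rw [mul_conjTranspose_mul_eq_smul_iff p n f M hM, hc]
  exact forall_congr' fun μ => (mul_star_mul_self_eq_iff _ hr).symm
end
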